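/- Fix integers N ≥ 1, K ≥ 1 and i ∈ {1,…,N}. Let (s_1,…,s_N) be a p-random sequence of strings of length K, and condition on the event that (s_1,…,s_i) equals a fixed nondecreasing tuple (t_1,…,t_i) whose last entry t_i does not begin with two (k−1)-digits. Then for any string x of length M ≤ K such that every string in B_x is lexicographically strictly greater than t_i, the conditional law of |I(B_x)| is stochastically dominated by the binomial distribution Bin(N, p_min^{−2}·λ_x). -/

import Mathlib

open Finset

namespace RiffleShuffle

/-- `phi p t = ∑ i, p i ^ t`. -/
noncomputable def phi {k : ℕ} (p : Fin k → ℝ) (t : ℝ) : ℝ := ∑ i, p i ^ t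

/-- `psi p t = - log (phi p t)`. -/
noncomputable def psi {k : ℕ} (p : Fin k → ℝ) (t : ℝ) : ℝ := - Real.log (phi p t)

/-- The maximal entry of `p`. -/
noncomputable def pmax {k : ℕ} (p : Fin k → ℝ) : ℝ := ⨆ i, p i

/-- The minimal entry of `p`. -/
noncomputable def pmin {k : ℕ} (p : Fin k → ℝ) : ℝ := ⨅ i, p i

/-- `C_p = (3+θ)/(4 ψ_p(2))`, where `θ` is the solution of `φ_p(θ) = φ_p(2)²`. -/
noncomputable def Cmain {k : ℕ} (p : Fin k → ℝ) (θ : ℝ) : ℝ := (3 + θ) / (4 * psi p 2)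

/-- `C̃_p = 1/log(1/p_max)`. -/
noncomputable def Ctilde {k : ℕ} (p : Fin k → ℝ) : ℝ := 1 / Real.log (1 / pmax p)

/-- `C̄_p = max(C̃_p, C_p)`. -/
noncomputable def Cbar {k : ℕ} (p : Fin k → ℝ) (θ : ℝ) : ℝ := max (Ctilde p) (Cmain p θ)

/-- Strings of length `K` over the alphabet `{0,…,k-1}`. -/
abbrev Str (k K : ℕ) := Fin K → Fin k

/-- Probability of an individual string, all digits i.i.d. with law `p`. -/
noncomputable def strP {k : ℕ} (p : Fin k → ℝ) {K : ℕ} (s : Str k K) : ℝ := ∏ j, p (s j)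

/-- Probability of a tuple of `N` i.i.d. `p`-random strings. -/
noncomputable def seqP {k : ℕ} (p : Fin k → ℝ) {N K : ℕ} (ω : Fin N → Str k K) : ℝ :=
  ∏ i, strP p (ω i)

/-- The base-`k` value of a string; comparing these values is exactly the lexicographic
order on strings of the same length. -/
def lexVal {k K : ℕ} (s : Str k K) : ℕ := ∑ j : Fin K, (s j : ℕ) * k ^ (K - 1 - (j : ℕ))

/-- The lexicographically sorted rearrangement of a tuple of strings. -/
noncomputable def sortedSeq {k N K : ℕ} (ω : Fin N → Str k K) : Fin N → Str k K :=
  fun i => ω (Tuple.sort (fun j => lexVal (ω j)) i)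

/-- The edge set of the shuffle graph of a (sorted) sequence of strings: the edge between
`i` and `i+1` is present iff `s i = s (i+1)`; edges are recorded as pairs `(i, i+1)`. -/
def edgeSet {k N K : ℕ} (s : Fin N → Str k K) : Finset (Fin N × Fin N) :=
  univ.filter (fun e => (e.2 : ℕ) = (e.1 : ℕ) + 1 ∧ s e.1 = s e.2)

/-- `s` begins with two digits equal to `d`. -/
def beginsWith2 {k : ℕ} (d : Fin k) {K : ℕ} (s : Str k K) : Prop :=
  ∃ h : 2 ≤ K, s ⟨0, by omega⟩ = d ∧ s ⟨1, by omega⟩ = d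

instance {k K : ℕ} (d : Fin k) (s : Str k K) : Decidable (beginsWith2 d s) :=
  exists_prop_decidable _

/-- The upper tail `P[Bin(N, q) ≥ m]` of the binomial distribution. -/
noncomputable def binomialTail (q : ℝ) (N m : ℕ) : ℝ :=
  ∑ j ∈ Finset.Icc m N, (N.choose j : ℝ) * q ^ j * (1 - q) ^ (N - j)

lemma binomialTail_zero_right (q : ℝ) (N : ℕ) : binomialTail q N 0 = 1 := by
  have h := add_pow q (1 - q) N
  rw [add_sub_cancel, one_pow] at h
  rw [binomialTail, ← Nat.range_succ_eq_Icc_zero, eq_comm]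
  refine h.trans ?_
  exact sum_congr rfl fun j _ => by ring

lemma binomialTail_anti {q : ℝ} (h0 : 0 ≤ q) (h1 : q ≤ 1) (N m : ℕ) :
    binomialTail q N (m + 1) ≤ binomialTail q N m := by
  refine sum_le_sum_of_subset_of_nonneg (Finset.Icc_subset_Icc_left (Nat.le_succ m)) ?_
  intro j _ _
  have := sub_nonneg.2 h1
  positivity

lemma binomialTail_succ (q : ℝ) (N m : ℕ) :
    binomialTail q (N + 1) (m + 1) =
      q * binomialTail q N m + (1 - q) * binomialTail q N (m + 1) := by
  have shift : ∀ f : ℕ → ℝ, ∑ j ∈ Finset.Icc (m + 1) (N + 1), f j =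
      ∑ j ∈ Finset.Icc m N, f (j + 1) := fun f => by
    rw [← Finset.map_add_right_Icc, sum_map]; rfl
  have hlast : binomialTail q N (m + 1) =
      ∑ j ∈ Finset.Icc (m + 1) (N + 1), (N.choose j : ℝ) * q ^ j * (1 - q) ^ (N - j) := by
    refine sum_subset (Finset.Icc_subset_Icc_right (Nat.le_succ N)) ?_
    intro j hj hj'
    rw [mem_Icc] at hj hj'
    rw [Nat.choose_eq_zero_of_lt (by omega)]
    simp
  rw [hlast, shift, binomialTail, shift, binomialTail, mul_sum, mul_sum, ← sum_add_distrib]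
  refine sum_congr rfl fun j hj => ?_
  have hjN := (mem_Icc.1 hj).2
  rw [Nat.choose_succ_succ, Nat.add_sub_add_right]
  rcases hjN.eq_or_lt with rfl | hlt
  · simp; ring
  · obtain ⟨d, rfl⟩ := Nat.exists_eq_add_of_lt hlt
    rw [show j + d + 1 - j = d + 1 by omega, show j + d + 1 - (j + 1) = d by omega]
    push_cast
    ring

lemma sum_filter_mul_le {S : Type*} [Fintype S] {w G : S → ℝ} {B H : S → Prop}
    [DecidablePred B] [DecidablePred H] (hw : ∀ s, 0 ≤ w s) (hG : ∀ s, 0 ≤ G s)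
    (hBH : ∀ s, B s → H s) {q : ℝ} (hq : 0 ≤ q)
    (hle : ∑ s with B s, w s ≤ q * ∑ s with H s, w s)
    (hconst : ∀ s s', H s → H s' → G s = G s') :
    ∑ s with B s, w s * G s ≤ q * ∑ s, w s * G s := by
  by_cases hB : ∃ s, B s
  · obtain ⟨a, ha⟩ := hB
    have key : ∀ P : S → Prop, ∀ [DecidablePred P], (∀ s, P s → H s) →
        ∑ s with P s, w s * G s = (∑ s with P s, w s) * G a := fun P _ hP => by
      rw [sum_mul]
      refine sum_congr rfl fun s hs => ?_
      rw [hconst s a (hP s (mem_filter.1 hs).2) (hBH a ha)]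
    calc ∑ s with B s, w s * G s = (∑ s with B s, w s) * G a := key B hBH
      _ ≤ (q * ∑ s with H s, w s) * G a := mul_le_mul_of_nonneg_right hle (hG a)
      _ = q * ∑ s with H s, w s * G s := by rw [key H fun _ h => h, mul_assoc]
      _ ≤ q * ∑ s, w s * G s := mul_le_mul_of_nonneg_left
          (sum_le_sum_of_subset_of_nonneg (filter_subset _ _)
            fun s _ _ => mul_nonneg (hw s) (hG s)) hq
  · rw [filter_false_of_mem fun s _ hs => hB ⟨s, hs⟩, sum_empty]
    exact mul_nonneg hq (sum_nonneg fun s _ => mul_nonneg (hw s) (hG s))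

lemma sum_fin_succ_pi {S : Type*} [Fintype S] (N : ℕ) (f : (Fin (N + 1) → S) → ℝ) :
    ∑ ω, f ω = ∑ s, ∑ ω : Fin N → S, f (Fin.cons s ω) := by
  rw [← (Fin.consEquiv fun _ : Fin (N + 1) => S).sum_comp, Fintype.sum_prod_type]
  rfl

/-- Under a product weight, conditioning on an event (more generally, tilting by `F`) that does
not distinguish the points of `H` makes the number of coordinates in `B ⊆ H` dominated by a
binomial variable with parameter `q ≥ w(B) / w(H)`. -/
lemma sum_tilted_le_binomialTail {S : Type*} [Fintype S] {w : S → ℝ} {B H : S → Prop}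
    [DecidablePred B] [DecidablePred H] (hw : ∀ s, 0 ≤ w s)
    (hBH : ∀ s, B s → H s) {q : ℝ} (hq0 : 0 ≤ q) (hq1 : q ≤ 1)
    (hle : ∑ s with B s, w s ≤ q * ∑ s with H s, w s) (N : ℕ) :
    ∀ (F : (Fin N → S) → ℝ), (∀ ω, 0 ≤ F ω) →
      (∀ ω ω', (∀ j, ω j = ω' j ∨ (H (ω j) ∧ H (ω' j))) → F ω = F ω') → ∀ m : ℕ,
      ∑ ω, F ω * (∏ j, w (ω j)) * (if m ≤ #{j | B (ω j)} then 1 else 0) ≤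
        binomialTail q N m * ∑ ω, F ω * ∏ j, w (ω j) := by
  induction N with
  | zero =>
    intro F hF _ m
    rcases m with _ | m
    · simp [binomialTail_zero_right]
    · simp [binomialTail]
  | succ N ih =>
    intro F hF hinv m
    rcases m with _ | m
    · simp [binomialTail_zero_right]
    set G : S → ℝ := fun s => ∑ ω : Fin N → S, F (Fin.cons s ω) * ∏ j, w (ω j) with hGdef
    have hG : ∀ s, 0 ≤ G s := fun s =>
      sum_nonneg fun ω _ => mul_nonneg (hF _) (prod_nonneg fun j _ => hw _)
    have hconst : ∀ s s', H s → H s' → G s = G s' := fun s s' hs hs' => by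
      refine sum_congr rfl fun ω _ => ?_
      rw [hinv (Fin.cons s ω) (Fin.cons s' ω)]
      intro j
      refine Fin.cases ?_ (fun j => ?_) j
      · exact Or.inr ⟨hs, hs'⟩
      · exact Or.inl rfl
    have ihs : ∀ (s : S) (n : ℕ),
        ∑ ω : Fin N → S, F (Fin.cons s ω) * (∏ j, w (ω j)) *
          (if n ≤ #{j | B (ω j)} then 1 else 0) ≤ binomialTail q N n * G s := fun s n => by
      refine ih (fun ω => F (Fin.cons s ω)) (fun ω => hF _) (fun ω ω' h => hinv _ _ ?_) n
      intro j
      refine Fin.cases ?_ (fun j => ?_) j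
      · exact Or.inl rfl
      · simpa using h j
    set a := binomialTail q N m
    set b := binomialTail q N (m + 1)
    have hab : b ≤ a := binomialTail_anti hq0 hq1 N m
    have hR : ∑ ω : Fin (N + 1) → S, F ω * ∏ j, w (ω j) = ∑ s, w s * G s := by
      rw [sum_fin_succ_pi]
      refine sum_congr rfl fun s _ => ?_
      rw [hGdef, mul_sum]
      refine sum_congr rfl fun ω _ => ?_
      rw [Fin.prod_univ_succ]
      simp only [Fin.cons_zero, Fin.cons_succ]
      ring
    have hL : ∑ ω : Fin (N + 1) → S, F ω * (∏ j, w (ω j)) *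
          (if m + 1 ≤ #{j | B (ω j)} then 1 else 0) ≤
        ∑ s, w s * ((if B s then a else b) * G s) := by
      rw [sum_fin_succ_pi]
      refine sum_le_sum fun s _ => ?_
      have hstep : (∑ ω : Fin N → S, F (Fin.cons s ω) * (∏ j, w (ω j)) *
          (if (if B s then m else m + 1) ≤ #{j | B (ω j)} then 1 else 0)) ≤
          (if B s then a else b) * G s := by
        refine (ihs s _).trans_eq ?_
        split_ifs <;> rfl
      refine le_of_eq_of_le ?_ (mul_le_mul_of_nonneg_left hstep (hw s))
      rw [mul_sum]
      refine sum_congr rfl fun ω _ => ?_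
      rw [Fin.prod_univ_succ, Fin.card_filter_univ_succ]
      simp only [Fin.cons_zero, Fin.cons_succ]
      have : (m + 1 ≤ if B s then #{j | B (ω j)} + 1 else #{j | B (ω j)}) ↔
          (if B s then m else m + 1) ≤ #{j | B (ω j)} := by
        split_ifs <;> simp
      simp only [this]
      ring
    have hsplit : ∑ s, w s * ((if B s then a else b) * G s) =
        b * ∑ s, w s * G s + (a - b) * ∑ s with B s, w s * G s := by
      rw [sum_filter, mul_sum, mul_sum, ← sum_add_distrib]
      refine sum_congr rfl fun s _ => ?_
      split_ifs <;> ring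
    rw [hR, binomialTail_succ]
    have := mul_le_mul_of_nonneg_left
      (sum_filter_mul_le hw hG hBH hq0 hle hconst) (sub_nonneg.2 hab)
    linarith

lemma lexVal_succ {k K : ℕ} (s : Str k (K + 1)) :
    lexVal s = (s 0 : ℕ) * k ^ K + lexVal (fun j => s j.succ) := by
  rw [lexVal, Fin.sum_univ_succ, lexVal]
  congr 1
  refine sum_congr rfl fun j _ => ?_
  rw [Fin.val_succ, show K + 1 - 1 - ((j : ℕ) + 1) = K - 1 - j by omega]

lemma lexVal_lt {k K : ℕ} (s : Str k K) : lexVal s < k ^ K := by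
  induction K with
  | zero => simp [lexVal]
  | succ K ih =>
    rw [lexVal_succ, pow_succ']
    have h1 := ih fun j => s j.succ
    have h2 := Nat.mul_le_mul_right (k ^ K) (Nat.succ_le_of_lt (s 0).isLt)
    rw [Nat.succ_mul] at h2
    omega

lemma lexVal_injective {k K : ℕ} : Function.Injective (lexVal : Str k K → ℕ) := by
  induction K with
  | zero => intro s t _; exact Subsingleton.elim s t
  | succ K ih =>
    intro s t h
    rw [lexVal_succ, lexVal_succ] at h
    have hs := lexVal_lt fun j => s j.succ
    have ht := lexVal_lt fun j => t j.succ
    have hdigit : (s 0 : ℕ) = t 0 := by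
      have := congrArg (· / k ^ K) h
      have hpos : 0 < k ^ K := by omega
      simpa [Nat.mul_add_div, mul_comm _ (k ^ K), Nat.div_eq_of_lt hs, Nat.div_eq_of_lt ht, hpos]
        using this
    rw [hdigit] at h
    have htail := ih (Nat.add_left_cancel h)
    funext j
    refine Fin.cases (Fin.ext hdigit) (fun j => congrFun htail j) j

lemma lexVal_lt_of_beginsWith2 {k K : ℕ} {d : Fin k} (hd : (d : ℕ) = k - 1) {s t : Str k K}
    (hs : beginsWith2 d s) (ht : ¬ beginsWith2 d t) : lexVal t < lexVal s := by
  obtain ⟨hK, hs0, hs1⟩ := hs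
  obtain ⟨K, rfl⟩ := Nat.exists_eq_add_of_le' hK
  have ht' : ¬ (t 0 = d ∧ t 1 = d) := fun h => ht ⟨hK, h⟩
  have hs0 : (s 0 : ℕ) = k - 1 := (congrArg Fin.val hs0).trans hd
  have hs1 : (s (Fin.succ 0) : ℕ) = k - 1 := (congrArg Fin.val hs1).trans hd
  have h0 := (t 0).isLt
  have h1 := (t 1).isLt
  rw [lexVal_succ t, lexVal_succ s, lexVal_succ (fun j => t j.succ),
    lexVal_succ (fun j => s j.succ), hs0, hs1]
  have hlow := lexVal_lt fun j : Fin K => t j.succ.succ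
  have hne : (t 0 : ℕ) * k + t 1 + 1 ≤ (k - 1) * k + (k - 1) := by
    by_cases h : (t 0 : ℕ) = k - 1
    · have : (t 1 : ℕ) ≠ k - 1 := fun h' =>
        ht' ⟨Fin.ext (h.trans hd.symm), Fin.ext (h'.trans hd.symm)⟩
      rw [h]
      omega
    · have := Nat.mul_le_mul_right k (show (t 0 : ℕ) + 1 ≤ k - 1 by omega)
      rw [Nat.succ_mul] at this
      omega
  have hmul := Nat.mul_le_mul_right (k ^ K) hne
  change (t 0 : ℕ) * k ^ (K + 1) + ((t 1 : ℕ) * k ^ K + _) < _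
  calc (t 0 : ℕ) * k ^ (K + 1) + ((t 1 : ℕ) * k ^ K + lexVal fun j : Fin K => t j.succ.succ)
      < (t 0 : ℕ) * k ^ (K + 1) + ((t 1 : ℕ) * k ^ K + k ^ K) := by omega
    _ = ((t 0 : ℕ) * k + t 1 + 1) * k ^ K := by ring
    _ ≤ ((k - 1) * k + (k - 1)) * k ^ K := hmul
    _ = (k - 1) * k ^ (K + 1) + (k - 1) * k ^ K := by ring
    _ ≤ _ := by omega

/-- The total probability of the strings with prefix `x` is `λ_x`. -/
lemma sum_strP_prefix {k : ℕ} {p : Fin k → ℝ} (hsum : ∑ i, p i = 1) {M K : ℕ} (hM : M ≤ K)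
    (x : Fin M → Fin k) :
    ∑ s : Str k K with ∀ j : Fin M, s ⟨j, lt_of_lt_of_le j.isLt hM⟩ = x j, strP p s =
      ∏ l, p (x l) := by
  have hset : (univ.filter fun s : Str k K =>
      ∀ j : Fin M, s ⟨j, lt_of_lt_of_le j.isLt hM⟩ = x j) =
      Fintype.piFinset fun j : Fin K =>
        if h : (j : ℕ) < M then ({x ⟨j, h⟩} : Finset (Fin k)) else univ := by
    ext s
    simp only [mem_filter, mem_univ, true_and, Fintype.mem_piFinset]
    constructor
    · intro h j
      split_ifs with hj
      · exact mem_singleton.2 (h ⟨j, hj⟩)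
      · exact mem_univ _
    · intro h j
      simpa using h ⟨j, lt_of_lt_of_le j.isLt hM⟩
  rw [hset]
  simp only [strP]
  rw [← prod_univ_sum]
  obtain ⟨d, rfl⟩ := Nat.exists_eq_add_of_le hM
  rw [Fin.prod_univ_add]
  simp [hsum]

lemma pmin_le {k : ℕ} (p : Fin k → ℝ) (i : Fin k) : pmin p ≤ p i :=
  ciInf_le (Set.finite_range p).bddBelow i

lemma pmin_pos {k : ℕ} [NeZero k] {p : Fin k → ℝ} (hpos : ∀ i, 0 < p i) : 0 < pmin p := by
  obtain ⟨i, hi⟩ := exists_eq_ciInf_of_finite (f := p)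
  rw [pmin, ← hi]
  exact hpos i

lemma strP_nonneg {k K : ℕ} {p : Fin k → ℝ} (hpos : ∀ i, 0 < p i) (s : Str k K) : 0 ≤ strP p s :=
  prod_nonneg fun _ _ => (hpos _).le

/-- If `t` is not the largest string and does not begin with two maximal digits, then a random
string exceeds `t` with probability at least `p_min ^ 2`. -/
lemma sq_pmin_le_sum_strP {k K : ℕ} [NeZero k] {p : Fin k → ℝ} (hpos : ∀ i, 0 < p i)
    (hsum : ∑ i, p i = 1) (hK : 1 ≤ K) {d : Fin k} (hd : (d : ℕ) = k - 1) {t : Str k K}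
    (ht : ¬ beginsWith2 d t) (hex : ∃ s : Str k K, lexVal t < lexVal s) :
    pmin p ^ 2 ≤ ∑ s : Str k K with lexVal t < lexVal s, strP p s := by
  have h0 := pmin_pos hpos
  rcases hK.eq_or_lt with rfl | hK2
  · obtain ⟨s, hs⟩ := hex
    have hle1 : pmin p ≤ 1 := (pmin_le p d).trans
      (hsum ▸ single_le_sum (fun i _ => (hpos i).le) (mem_univ d))
    calc pmin p ^ 2 ≤ pmin p := by nlinarith
      _ ≤ strP p s := by simpa [strP] using pmin_le p (s 0)
      _ ≤ _ := single_le_sum (f := fun s => strP p s) (fun s _ => strP_nonneg hpos s)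
          (mem_filter.2 ⟨mem_univ s, hs⟩)
  · calc pmin p ^ 2 ≤ ∏ _l : Fin 2, p d := by
          rw [prod_const, card_univ, Fintype.card_fin]
          exact pow_le_pow_left₀ h0.le (pmin_le p d) 2
      _ = _ := (sum_strP_prefix hsum hK2 fun _ => d).symm
      _ ≤ _ := by
          refine sum_le_sum_of_subset_of_nonneg (fun s hs => ?_) fun s _ _ => strP_nonneg hpos s
          have hs := (mem_filter.1 hs).2
          exact mem_filter.2 ⟨mem_univ s, lexVal_lt_of_beginsWith2 hd ⟨hK2, hs 0, hs 1⟩ ht⟩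

lemma monotone_lexVal_sortedSeq {k N K : ℕ} (ω : Fin N → Str k K) :
    Monotone fun j => lexVal (sortedSeq ω j) :=
  Tuple.monotone_sort fun j => lexVal (ω j)

lemma card_filter_sortedSeq {k N K : ℕ} (ω : Fin N → Str k K) (P : Str k K → Prop)
    [DecidablePred P] : #{j | P (sortedSeq ω j)} = #{j | P (ω j)} :=
  card_equiv (Tuple.sort fun j => lexVal (ω j)) fun j => by
    rw [mem_filter_univ, mem_filter_univ]; rfl

lemma lexVal_sortedSeq_le_iff {k N K : ℕ} (ω : Fin N → Str k K) (j : Fin N) (c : ℕ) :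
    lexVal (sortedSeq ω j) ≤ c ↔ (j : ℕ) < #{l | lexVal (ω l) ≤ c} := by
  rw [← card_filter_sortedSeq ω fun s => lexVal s ≤ c]
  exact (Tuple.lt_card_le_iff_apply_le_of_monotone (monotone_lexVal_sortedSeq ω)).symm

/-- The entries of the sorted sequence up to a threshold do not depend on the strings above
that threshold. -/
lemma sortedSeq_eq_of_agree {k N K : ℕ} {T : ℕ} {ω ω' : Fin N → Str k K}
    (h : ∀ j, ω j = ω' j ∨ (T < lexVal (ω j) ∧ T < lexVal (ω' j))) {j : Fin N}
    (hj : lexVal (sortedSeq ω j) ≤ T) : sortedSeq ω' j = sortedSeq ω j := by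
  have hiff : ∀ c ≤ T, (lexVal (sortedSeq ω j) ≤ c ↔ lexVal (sortedSeq ω' j) ≤ c) := by
    intro c hc
    rw [lexVal_sortedSeq_le_iff, lexVal_sortedSeq_le_iff]
    have : (univ.filter fun l => lexVal (ω l) ≤ c) = univ.filter fun l => lexVal (ω' l) ≤ c := by
      refine filter_congr fun l _ => ?_
      rcases h l with h | h
      · rw [h]
      · constructor <;> intro <;> omega
    rw [this]
  have hle := (hiff _ hj).1 le_rfl
  exact lexVal_injective (le_antisymm hle ((hiff _ (hle.trans hj)).2 le_rfl))

/-- **Lemma (conditional binomial domination)**: conditioned on the first `i` sorted strings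
being a fixed nondecreasing tuple whose last entry does not begin with two `(k-1)`-digits, for
any prefix `x` (of length `M ≤ K`, with every string in the block `B_x` lexicographically
strictly greater than that last entry) the conditional law of `|I(B_x)|` is stochastically
dominated by a `Bin(N, p_min^{-2} λ_x)` random variable.  (The binomial parameter is clamped
at `1`, as a probability must be; domination is stated through all upper tails, in the form
`P[cond ∧ |I(B_x)| ≥ m] ≤ P[Bin ≥ m] ⬝ P[cond]`.) -/
theorem conditional_binomial_domination (k : ℕ) (hk : 2 ≤ k) (p : Fin k → ℝ)
    (hpos : ∀ i, 0 < p i) (hsum : ∑ i, p i = 1)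
    (N K : ℕ) (hN : 1 ≤ N) (hK : 1 ≤ K)
    (i : ℕ) (h1 : 1 ≤ i) (hiN : i ≤ N)
    (τ : Fin N → Str k K)
    (hτmono : ∀ j j' : Fin N, j ≤ j' → (j' : ℕ) < i → lexVal (τ j) ≤ lexVal (τ j'))
    (hτlast : ¬ beginsWith2 ⟨k - 1, by omega⟩ (τ ⟨i - 1, by omega⟩))
    (M : ℕ) (hM : M ≤ K) (x : Fin M → Fin k)
    (hblock : ∀ s : Str k K,
      (∀ j : Fin M, s ⟨(j : ℕ), lt_of_lt_of_le j.isLt hM⟩ = x j) →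
      lexVal (τ ⟨i - 1, by omega⟩) < lexVal s) :
    ∀ m : ℕ,
      ∑ ω ∈ univ.filter (fun ω : Fin N → Str k K =>
          (∀ j : Fin N, (j : ℕ) < i → sortedSeq ω j = τ j) ∧
            m ≤ (univ.filter (fun j : Fin N =>
                ∀ jj : Fin M, sortedSeq ω j ⟨(jj : ℕ), lt_of_lt_of_le jj.isLt hM⟩ = x jj)).card),
        seqP p ω
      ≤ (∑ j ∈ Finset.Icc m N, (N.choose j : ℝ) *
            (min 1 ((pmin p ^ 2)⁻¹ * ∏ l, p (x l))) ^ j *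
            (1 - min 1 ((pmin p ^ 2)⁻¹ * ∏ l, p (x l))) ^ (N - j)) *
          ∑ ω ∈ univ.filter (fun ω : Fin N → Str k K =>
              ∀ j : Fin N, (j : ℕ) < i → sortedSeq ω j = τ j),
            seqP p ω := by
  intro m
  have : NeZero k := ⟨by omega⟩
  set t := τ ⟨i - 1, by omega⟩
  set q : ℝ := min 1 ((pmin p ^ 2)⁻¹ * ∏ l, p (x l)) with hq
  have hpmin := pmin_pos hpos
  have hlam : 0 ≤ ∏ l, p (x l) := prod_nonneg fun l _ => (hpos _).le
  have hq0 : 0 ≤ q := le_min zero_le_one (by positivity)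
  let B : Str k K → Prop := fun s => ∀ j : Fin M, s ⟨(j : ℕ), lt_of_lt_of_le j.isLt hM⟩ = x j
  let H : Str k K → Prop := fun s => lexVal t < lexVal s
  have hex : ∃ s : Str k K, lexVal t < lexVal s :=
    ⟨fun j => if h : (j : ℕ) < M then x ⟨j, h⟩ else 0, hblock _ fun j => by simp⟩
  have hle : ∑ s with B s, strP p s ≤ q * ∑ s with H s, strP p s := by
    have hH := sq_pmin_le_sum_strP hpos hsum hK rfl hτlast hex
    have hB : ∑ s with B s, strP p s = ∏ l, p (x l) := sum_strP_prefix hsum hM x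
    rw [hq]
    rcases min_choice (1 : ℝ) ((pmin p ^ 2)⁻¹ * ∏ l, p (x l)) with h | h <;> rw [h]
    · rw [one_mul]
      exact sum_le_sum_of_subset_of_nonneg (monotone_filter_right _ fun s _ hs => hblock s hs)
        fun s _ _ => strP_nonneg hpos s
    · rw [hB]
      calc ∏ l, p (x l) = ((pmin p ^ 2)⁻¹ * ∏ l, p (x l)) * pmin p ^ 2 := by field_simp
        _ ≤ _ := mul_le_mul_of_nonneg_left hH (by positivity)
  let E : (Fin N → Str k K) → Prop := fun ω => ∀ j : Fin N, (j : ℕ) < i → sortedSeq ω j = τ j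
  have hE : ∀ ω ω' : Fin N → Str k K,
      (∀ j, ω j = ω' j ∨ (H (ω j) ∧ H (ω' j))) → E ω → E ω' := by
    intro ω ω' h hω j hj
    rw [← hω j hj]
    refine sortedSeq_eq_of_agree h ?_
    rw [hω j hj]
    exact hτmono j ⟨i - 1, by omega⟩ (Fin.le_def.2 (by simp only; omega)) (by simp only; omega)
  have main := sum_tilted_le_binomialTail (strP_nonneg hpos) hblock hq0 (min_le_left _ _) hle N
    (fun ω => if E ω then 1 else 0) (fun ω => by positivity)
    (fun ω ω' h => if_congr ⟨hE ω ω' h, hE ω' ω fun j => (h j).imp Eq.symm And.symm⟩ rfl rfl) m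
  refine (le_of_eq ?_).trans (main.trans (le_of_eq ?_))
  · rw [sum_filter]
    refine sum_congr rfl fun ω _ => ?_
    rw [card_filter_sortedSeq ω B, ite_and]
    change (if E ω then _ else _) = _
    split_ifs <;> simp [seqP]
  · rw [sum_filter, binomialTail]
    congr 1
    refine sum_congr rfl fun ω _ => ?_
    change _ = if E ω then _ else _
    split_ifs <;> simp [seqP]

end RiffleShuffle
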